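/- Corollary (GBDT in the Lagrange-symmetric case): assume the initial Shin-Zettl system is Lagrange-symmetric, i.e. ω, p, q are real-valued and r := r₁ = −conj(r₂). Choose matrices A, Π(0), S(0) with S(0) = S(0)* and AS(0) − S(0)A* = iΠ(0)σ₂Π(0)*, and let Π(x), S(x) solve Π′ = −AΠJH₁ − ΠJH₀, S′ = ΠJH₁J*Π* with J = iσ₂ = [[0,1],[−1,0]], H₁ = [[ω,0],[0,0]], H₀ = [[−q, conj(r)],[r, p⁻¹]]; set X(x) = JΠ(x)*S(x)⁻¹Π(x). Then (i) the transformed Shin-Zettl system has coefficients r̃₁ = −conj(r̃₂) = r − ωX₁₂ and q̃ = q + ω(X₁₁ + conj(X₁₁)), hence is Lagrange-symmetric (in particular X₁₂ is real-valued and X₂₂ = −conj(X₁₁)); and (ii) if y solves the initial system, then ỹ(x,λ) = w_A(x,λ)y(x,λ), with w_A(x,λ) = I₂ − iσ₂Π(x)*S(x)⁻¹(A − λI_n)⁻¹Π(x), solves the transformed system at points where S(x) and (A − λI_n) are invertible. -/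

import Mathlib

open Matrix Set

section Inverse

attribute [local instance] Matrix.linftyOpNormedRing Matrix.linftyOpNormedAlgebra

theorem HasDerivAt.matrix_inv {n : Type*} [Fintype n] [DecidableEq n]
    {M : ℝ → Matrix n n ℂ} {M' : Matrix n n ℂ} {x : ℝ} (hM : HasDerivAt M M' x)
    (hx : IsUnit (M x)) :
    HasDerivAt (fun t => (M t)⁻¹) (-((M x)⁻¹ * M' * (M x)⁻¹)) x := by
  have : CompleteSpace (Matrix n n ℂ) := FiniteDimensional.complete ℝ _
  obtain ⟨u, hu⟩ := hx
  have hinv := hasFDerivAt_ringInverse (𝕜 := ℝ) u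
  rw [hu] at hinv
  have hcomp := hinv.comp_hasDerivAt x hM
  simp only [nonsing_inv_eq_ringInverse, ← hu, Ring.inverse_unit]
  exact hcomp.congr_deriv (by simp)

end Inverse

attribute [local instance] Matrix.normedAddCommGroup Matrix.normedSpace

theorem hasDerivAt_matrix_iff {m n : Type*} [Fintype m] [Fintype n]
    {M : ℝ → Matrix m n ℂ} {M' : Matrix m n ℂ} {x : ℝ} :
    HasDerivAt M M' x ↔ ∀ i j, HasDerivAt (fun t => M t i j) (M' i j) x :=
  (hasDerivAt_pi (φ := M)).trans (forall_congr' fun _ => hasDerivAt_pi)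

theorem HasDerivAt.matrix_mul {l m n : Type*} [Fintype l] [Fintype m] [Fintype n]
    {M : ℝ → Matrix l m ℂ} {M' : Matrix l m ℂ} {N : ℝ → Matrix m n ℂ} {N' : Matrix m n ℂ} {x : ℝ}
    (hM : HasDerivAt M M' x) (hN : HasDerivAt N N' x) :
    HasDerivAt (fun t => M t * N t) (M' * N x + M x * N') x := by
  rw [hasDerivAt_matrix_iff] at *
  intro i j
  simp only [Matrix.add_apply, Matrix.mul_apply, ← Finset.sum_add_distrib]
  exact HasDerivAt.fun_sum fun k _ => (hM i k).mul (hN k j)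

theorem HasDerivAt.matrix_mulVec {m n : Type*} [Fintype m] [Fintype n]
    {M : ℝ → Matrix m n ℂ} {M' : Matrix m n ℂ} {v : ℝ → n → ℂ} {v' : n → ℂ} {x : ℝ}
    (hM : HasDerivAt M M' x) (hv : HasDerivAt v v' x) :
    HasDerivAt (fun t => M t *ᵥ v t) (M' *ᵥ v x + M x *ᵥ v') x := by
  rw [hasDerivAt_matrix_iff] at hM
  rw [hasDerivAt_pi] at *
  intro i
  simp only [Pi.add_apply, Matrix.mulVec, dotProduct, ← Finset.sum_add_distrib]
  exact HasDerivAt.fun_sum fun k _ => (hM i k).mul (hv k)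

theorem HasDerivAt.matrix_conjTranspose {m n : Type*} [Fintype m] [Fintype n]
    {M : ℝ → Matrix m n ℂ} {M' : Matrix m n ℂ} {x : ℝ} (hM : HasDerivAt M M' x) :
    HasDerivAt (fun t => (M t)ᴴ) M'ᴴ x := by
  rw [hasDerivAt_matrix_iff] at *
  exact fun i j => (hM j i).star

theorem eq_of_hasDerivAt_zero {E : Type*} [NormedAddCommGroup E] [NormedSpace ℝ E]
    {f : ℝ → E} {ℓ : ℝ} (hf : ∀ x ∈ Ico (0 : ℝ) ℓ, HasDerivAt f 0 x) :
    ∀ x ∈ Ico (0 : ℝ) ℓ, f x = f 0 := by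
  intro x hx
  have hmem : ∀ t ∈ Icc 0 x, t ∈ Ico (0 : ℝ) ℓ := fun t ht => ⟨ht.1, ht.2.trans_lt hx.2⟩
  exact constant_of_has_deriv_right_zero
    (fun t ht => (hf t (hmem t ht)).continuousAt.continuousWithinAt)
    (fun t ht => (hf t (hmem t (Ico_subset_Icc_self ht))).hasDerivWithinAt) x ⟨hx.1, le_rfl⟩

section GBDT

variable {n m : Type*} [Fintype n] [Fintype m]

/-- The identity `AS - SA* = ΠJΠ*` is preserved along solutions of the GBDT equations. -/
theorem gbdt_identity {A : Matrix n n ℂ} {B : ℝ → Matrix n m ℂ} {S : ℝ → Matrix n n ℂ}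
    {J : Matrix m m ℂ} {H₁ H₀ : ℝ → Matrix m m ℂ} {ℓ : ℝ}
    (hJ : Jᴴ = -J) (hH₁ : ∀ x, (H₁ x)ᴴ = H₁ x) (hH₀ : ∀ x, (H₀ x)ᴴ = H₀ x)
    (hinit : A * S 0 - S 0 * Aᴴ = B 0 * J * (B 0)ᴴ)
    (hB : ∀ x ∈ Ico (0 : ℝ) ℓ, HasDerivAt B (-(A * B x * J * H₁ x) - B x * J * H₀ x) x)
    (hS : ∀ x ∈ Ico (0 : ℝ) ℓ, HasDerivAt S (B x * J * H₁ x * Jᴴ * (B x)ᴴ) x) :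
    ∀ x ∈ Ico (0 : ℝ) ℓ, A * S x - S x * Aᴴ = B x * J * (B x)ᴴ := by
  intro x hx
  have hconst : ∀ t ∈ Ico (0 : ℝ) ℓ,
      HasDerivAt (fun t => A * S t - S t * Aᴴ - B t * J * (B t)ᴴ) 0 t := by
    intro t ht
    refine ((((hasDerivAt_const t A).matrix_mul (hS t ht)).sub
      ((hS t ht).matrix_mul (hasDerivAt_const t Aᴴ))).sub
      (((hB t ht).matrix_mul (hasDerivAt_const t J)).matrix_mul
        (hB t ht).matrix_conjTranspose)).congr_deriv ?_
    simp only [conjTranspose_sub, conjTranspose_neg, conjTranspose_mul, hJ, hH₁, hH₀,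
      Matrix.add_mul, Matrix.mul_sub, Matrix.sub_mul, Matrix.mul_neg,
      Matrix.neg_mul, Matrix.mul_assoc, Matrix.mul_zero, Matrix.zero_mul]
    abel
  have h := eq_of_hasDerivAt_zero hconst x hx
  simp only [hinit, sub_self] at h
  exact sub_eq_zero.mp h

/-- Hermiticity of `S` is preserved along solutions of `S' = ΠJH₁J*Π*`. -/
theorem gbdt_isHermitian {B : ℝ → Matrix n m ℂ} {S : ℝ → Matrix n n ℂ}
    {J : Matrix m m ℂ} {H₁ : ℝ → Matrix m m ℂ} {ℓ : ℝ}
    (hH₁ : ∀ x, (H₁ x)ᴴ = H₁ x) (hinit : (S 0).IsHermitian)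
    (hS : ∀ x ∈ Ico (0 : ℝ) ℓ, HasDerivAt S (B x * J * H₁ x * Jᴴ * (B x)ᴴ) x) :
    ∀ x ∈ Ico (0 : ℝ) ℓ, (S x).IsHermitian := by
  intro x hx
  have hconst : ∀ t ∈ Ico (0 : ℝ) ℓ, HasDerivAt (fun t => (S t)ᴴ - S t) 0 t := by
    intro t ht
    refine ((hS t ht).matrix_conjTranspose.sub (hS t ht)).congr_deriv ?_
    simp only [conjTranspose_mul, conjTranspose_conjTranspose, hH₁, Matrix.mul_assoc, sub_self]
  have h := eq_of_hasDerivAt_zero hconst x hx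
  simp only [hinit.eq, sub_self] at h
  exact sub_eq_zero.mp h

/-- The Darboux matrix `w = 1 - JΠ*S⁻¹(A - λ)⁻¹Π` satisfies `w' = J(λH₁ + H₀ + Z)w - wJ(λH₁ + H₀)`
with `Z = Π*S⁻¹ΠJH₁ + H₁J*Π*S⁻¹Π`. -/
theorem hasDerivAt_darbouxMatrix [DecidableEq n] [DecidableEq m] {A : Matrix n n ℂ} {B : ℝ → Matrix n m ℂ}
    {S : ℝ → Matrix n n ℂ} {J H₁ H₀ : Matrix m m ℂ} {lam : ℂ} {x : ℝ}
    (hJ : Jᴴ = -J) (hH₁ : H₁ᴴ = H₁) (hH₀ : H₀ᴴ = H₀)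
    (hid : A * S x - S x * Aᴴ = B x * J * (B x)ᴴ)
    (hB : HasDerivAt B (-(A * B x * J * H₁) - B x * J * H₀) x)
    (hS : HasDerivAt S (B x * J * H₁ * Jᴴ * (B x)ᴴ) x)
    (hSx : IsUnit (S x)) (hA : IsUnit (A - lam • 1)) :
    let w := fun t => 1 - J * (B t)ᴴ * (S t)⁻¹ * ((A - lam • 1)⁻¹ * B t)
    HasDerivAt w
      (J * (lam • H₁ + (H₀ + ((B x)ᴴ * (S x)⁻¹ * B x * J * H₁
        + H₁ * Jᴴ * (B x)ᴴ * (S x)⁻¹ * B x))) * w x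
        - w x * (J * (lam • H₁ + H₀))) x := by
  have hSdet := (isUnit_iff_isUnit_det _).mp hSx
  have hAdet := (isUnit_iff_isUnit_det _).mp hA
  have hderiv := (hasDerivAt_const x (1 : Matrix m m ℂ)).sub
    ((((hasDerivAt_const x J).matrix_mul hB.matrix_conjTranspose).matrix_mul
      (hS.matrix_inv hSx)).matrix_mul
      ((hasDerivAt_const x (A - lam • 1 : Matrix n n ℂ)⁻¹).matrix_mul hB))
  have hcomm : Aᴴ * (S x)⁻¹ = (S x)⁻¹ * A - (S x)⁻¹ * (B x * J * (B x)ᴴ) * (S x)⁻¹ := by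
    rw [← hid, Matrix.mul_sub, Matrix.sub_mul, ← Matrix.mul_assoc, ← Matrix.mul_assoc,
      nonsing_inv_mul _ hSdet, Matrix.one_mul, Matrix.mul_assoc, Matrix.mul_assoc,
      mul_nonsing_inv _ hSdet, Matrix.mul_one, sub_sub_cancel]
  have hcomm' (M : Matrix n m ℂ) : Aᴴ * ((S x)⁻¹ * M)
      = (S x)⁻¹ * (A * M) - (S x)⁻¹ * (B x * (J * ((B x)ᴴ * ((S x)⁻¹ * M)))) := by
    rw [← Matrix.mul_assoc, hcomm]
    simp only [Matrix.sub_mul, Matrix.mul_assoc]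
  have hAR (M : Matrix n m ℂ) :
      A * ((A - lam • 1)⁻¹ * M) = M + lam • ((A - lam • 1)⁻¹ * M) := by
    have h : (A - lam • 1) * ((A - lam • 1)⁻¹ * M) = M := by
      rw [← Matrix.mul_assoc, mul_nonsing_inv _ hAdet, Matrix.one_mul]
    rwa [Matrix.sub_mul, Matrix.smul_mul, Matrix.one_mul, sub_eq_iff_eq_add] at h
  have hRA (M : Matrix n m ℂ) :
      (A - lam • 1)⁻¹ * (A * M) = M + lam • ((A - lam • 1)⁻¹ * M) := by
    have h : (A - lam • 1)⁻¹ * ((A - lam • 1) * M) = M := by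
      rw [← Matrix.mul_assoc, nonsing_inv_mul _ hAdet, Matrix.one_mul]
    rwa [Matrix.sub_mul, Matrix.smul_mul, Matrix.one_mul, Matrix.mul_sub, Matrix.mul_smul,
      sub_eq_iff_eq_add] at h
  intro w
  refine hderiv.congr_deriv ?_
  simp only [w]
  generalize (A - lam • 1)⁻¹ = R at *
  simp only [conjTranspose_sub, conjTranspose_neg, conjTranspose_mul, hJ, hH₁, hH₀,
    Matrix.mul_add, Matrix.add_mul, Matrix.mul_sub, Matrix.sub_mul, Matrix.mul_neg,
    Matrix.neg_mul, Matrix.mul_assoc, Matrix.mul_zero, Matrix.zero_mul, Matrix.mul_one,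
    Matrix.one_mul, hcomm', hAR, hRA, Matrix.mul_smul, Matrix.smul_mul]
  module

end GBDT

/-- **GBDT in the Lagrange-symmetric case.**  Assume the initial Shin-Zettl system is
Lagrange-symmetric: `ω, p, q` real-valued and `r = r₁ = −conj r₂`, i.e.
`y' = J(λH₁ + H₀)y` with `J = iσ₂ = [[0,1],[−1,0]]`, `H₁ = [[ω,0],[0,0]]`,
`H₀ = [[−q, conj r],[r, p⁻¹]]`.  Choose `A`, `Π(0)`, `S(0) = S(0)*` with
`AS(0) − S(0)A* = iΠ(0)σ₂Π(0)*`, let `Π, S` solve the GBDT equations and set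
`X = JΠ*S⁻¹Π`.  Then `X₁₂` is real, `X₂₂ = −conj X₁₁`, the transformed system has the
Lagrange-symmetric coefficient matrix `H̃₀ = [[−q̃, conj r̃],[r̃, p⁻¹]]` with
`r̃ = r − ωX₁₂`, `q̃ = q + ω(X₁₁ + conj X₁₁)`, and `ỹ = w_A y` solves the transformed
system at points where `S(x)` and `A − λI` are invertible. -/
theorem gbdt_lagrange_symmetric
    (n : ℕ) (ℓ : ℝ) (lam : ℂ)
    (ω p q : ℝ → ℝ) (r : ℝ → ℂ)
    (J σ₂ : Matrix (Fin 2) (Fin 2) ℂ)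
    (hσ₂ : σ₂ = !![0, -Complex.I; Complex.I, 0])
    (hJ : J = Complex.I • σ₂)
    (H₁ H₀ : ℝ → Matrix (Fin 2) (Fin 2) ℂ)
    (hH₁ : H₁ = fun x => !![(ω x : ℂ), 0; 0, 0])
    (hH₀ : H₀ = fun x => !![-(q x : ℂ), (starRingEnd ℂ) (r x); r x, ((p x : ℂ))⁻¹])
    (A : Matrix (Fin n) (Fin n) ℂ)
    (Pi : ℝ → Matrix (Fin n) (Fin 2) ℂ)
    (S : ℝ → Matrix (Fin n) (Fin n) ℂ)
    (hS0 : (S 0).IsHermitian)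
    (hInit : A * S 0 - S 0 * Aᴴ = Complex.I • (Pi 0 * σ₂ * (Pi 0)ᴴ))
    (hPi : ∀ x ∈ Ico (0 : ℝ) ℓ,
      HasDerivAt Pi (-(A * Pi x * J * H₁ x) - Pi x * J * H₀ x) x)
    (hS : ∀ x ∈ Ico (0 : ℝ) ℓ,
      HasDerivAt S (Pi x * J * H₁ x * Jᴴ * (Pi x)ᴴ) x)
    (X : ℝ → Matrix (Fin 2) (Fin 2) ℂ)
    (hX : X = fun x => J * (Pi x)ᴴ * (S x)⁻¹ * Pi x)
    (Z : ℝ → Matrix (Fin 2) (Fin 2) ℂ)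
    (hZ : Z = fun x =>
      (Pi x)ᴴ * (S x)⁻¹ * Pi x * J * H₁ x + H₁ x * Jᴴ * (Pi x)ᴴ * (S x)⁻¹ * Pi x)
    (wA : ℝ → Matrix (Fin 2) (Fin 2) ℂ)
    (hwA : wA = fun x =>
      1 - Complex.I • (σ₂ * (Pi x)ᴴ * (S x)⁻¹ * ((A - lam • 1)⁻¹ * Pi x)))
    (y : ℝ → Fin 2 → ℂ)
    (hy : ∀ x ∈ Ico (0 : ℝ) ℓ, HasDerivAt y ((J * (lam • H₁ x + H₀ x)) *ᵥ y x) x) :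
    ∀ x ∈ Ico (0 : ℝ) ℓ, IsUnit (S x) → IsUnit (A - lam • 1) →
      -- (L7): `X₁₂` is real-valued and `X₂₂ = −conj X₁₁`
      (starRingEnd ℂ) (X x 0 1) = X x 0 1 ∧
      X x 1 1 = -((starRingEnd ℂ) (X x 0 0)) ∧
      -- the transformed system is Lagrange-symmetric with the stated coefficients
      H₀ x + Z x = !![-((q x : ℂ) + (ω x : ℂ) * (X x 0 0 + (starRingEnd ℂ) (X x 0 0))),
          (starRingEnd ℂ) (r x - (ω x : ℂ) * X x 0 1);
          r x - (ω x : ℂ) * X x 0 1, ((p x : ℂ))⁻¹] ∧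
      -- `ỹ = w_A y` solves the transformed system
      HasDerivAt (fun t => wA t *ᵥ y t)
        ((J * (lam • H₁ x + (H₀ x + Z x))) *ᵥ (wA x *ᵥ y x)) x := by
  intro x hx hSx hA
  have hJσ : J = !![0, 1; -1, 0] := by
    rw [hJ, hσ₂]
    ext i j
    fin_cases i <;> fin_cases j <;> simp
  have hJstar : Jᴴ = -J := by
    rw [hJσ]
    ext i j
    fin_cases i <;> fin_cases j <;> simp
  have hH₁star (t : ℝ) : (H₁ t)ᴴ = H₁ t := by
    rw [hH₁]
    ext i j
    fin_cases i <;> fin_cases j <;> simp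
  have hH₀star (t : ℝ) : (H₀ t)ᴴ = H₀ t := by
    rw [hH₀]
    ext i j
    fin_cases i <;> fin_cases j <;> simp
  have hid := gbdt_identity hJstar hH₁star hH₀star
    (by rw [hInit, hJ, Matrix.mul_smul, Matrix.smul_mul]) hPi hS x hx
  have hSherm := gbdt_isHermitian hH₁star hS0 hS x hx
  have hXx : X x = J * ((Pi x)ᴴ * (S x)⁻¹ * Pi x) := by
    simp only [hX, Matrix.mul_assoc]
  have hZx : Z x = (Pi x)ᴴ * (S x)⁻¹ * Pi x * J * H₁ x
      + H₁ x * Jᴴ * ((Pi x)ᴴ * (S x)⁻¹ * Pi x) := by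
    simp only [hZ, Matrix.mul_assoc]
  have hK : ((Pi x)ᴴ * (S x)⁻¹ * Pi x).IsHermitian :=
    isHermitian_conjTranspose_mul_mul _ hSherm.inv
  generalize (Pi x)ᴴ * (S x)⁻¹ * Pi x = K at hXx hZx hK
  have hK₁₁ : (starRingEnd ℂ) (K 1 1) = K 1 1 := hK.apply 1 1
  have hK₀₁ : (starRingEnd ℂ) (K 1 0) = K 0 1 := hK.apply 0 1
  have hw := hasDerivAt_darbouxMatrix (lam := lam) hJstar (hH₁star x) (hH₀star x) hid
    (hPi x hx) (hS x hx) hSx hA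
  have hwA' : wA = fun t => 1 - J * (Pi t)ᴴ * (S t)⁻¹ * ((A - lam • 1)⁻¹ * Pi t) := by
    simp only [hwA, hJ, Matrix.smul_mul]
  rw [← hwA'] at hw
  refine ⟨?_, ?_, ?_, ?_⟩
  · simpa [hXx, hJσ, Matrix.mul_apply] using hK₁₁
  · simpa [hXx, hJσ, Matrix.mul_apply] using hK₀₁.symm
  · rw [hZx, hXx, hH₀, hH₁, hJstar, hJσ]
    ext i j
    fin_cases i <;> fin_cases j <;>
      simp [Matrix.mul_apply, vecMul, dotProduct, hK₁₁, hK₀₁] <;> ring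
  · convert hw.matrix_mulVec (hy x hx) using 1
    simp only [hZ, Matrix.sub_mulVec, Matrix.mulVec_mulVec, sub_add_cancel]
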